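/- The set α = {(1/2, √3/16), (1/2, 3√3/8)} is an optimal set of two-means for P, and the second quantization error is V₂(P) = 117/1408. -/

import Mathlib

open MeasureTheory Real Set
open scoped ENNReal NNReal

/-- The three contractive similarities generating the nonhomogeneous R-triangle.
Letters 1,2,3 of the paper correspond to `0,1,2 : Fin 3`. -/
noncomputable def Smap : Fin 3 → ℝ × ℝ → ℝ × ℝ :=
  ![fun x => (x.1 / 4, x.2 / 4),
    fun x => (x.1 / 4 + 3 / 4, x.2 / 4),
    fun x => (x.1 / 2 + 1 / 4, x.2 / 2 + Real.sqrt 3 / 4)]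

/-- `Sw ω = S_{ω₁} ∘ ⋯ ∘ S_{ω_k}` for a word `ω = ω₁⋯ω_k`. -/
noncomputable def Sw (ω : List (Fin 3)) : ℝ × ℝ → ℝ × ℝ :=
  (ω.map Smap).foldr (· ∘ ·) id

/-- The probability weights `p₁ = p₂ = 1/5`, `p₃ = 3/5`. -/
noncomputable def pr : Fin 3 → ℝ := ![1/5, 1/5, 3/5]

/-- The similarity ratios `s₁ = s₂ = 1/4`, `s₃ = 1/2`. -/
noncomputable def sr : Fin 3 → ℝ := ![1/4, 1/4, 1/2]

/-- `p_ω = p_{ω₁}⋯p_{ω_k}`. -/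
noncomputable def pw (ω : List (Fin 3)) : ℝ := (ω.map pr).prod

/-- `s_ω = s_{ω₁}⋯s_{ω_k}`. -/
noncomputable def sw (ω : List (Fin 3)) : ℝ := (ω.map sr).prod

/-- `P` is the nonhomogeneous R-measure:
`P = (1/5)·P∘S₁⁻¹ + (1/5)·P∘S₂⁻¹ + (3/5)·P∘S₃⁻¹`. -/
def IsRMeasure (P : Measure (ℝ × ℝ)) : Prop :=
  P = (1/5 : ℝ≥0∞) • P.map (Smap 0) + (1/5 : ℝ≥0∞) • P.map (Smap 1)
        + (3/5 : ℝ≥0∞) • P.map (Smap 2)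

/-- The closed equilateral triangle with vertices (0,0), (1,0), (1/2, √3/2). -/
noncomputable def Δtri : Set (ℝ × ℝ) :=
  convexHull ℝ ({(0, 0), (1, 0), (1/2, Real.sqrt 3 / 2)} : Set (ℝ × ℝ))

/-- Squared Euclidean distance on ℝ². -/
def sqDist (x a : ℝ × ℝ) : ℝ := (x.1 - a.1) ^ 2 + (x.2 - a.2) ^ 2

/-- The distortion error `∫ min_{a ∈ α} ‖x − a‖² dP(x)` of a set `α` (Euclidean norm). -/
noncomputable def distortion (P : Measure (ℝ × ℝ)) (α : Set (ℝ × ℝ)) : ℝ :=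
  ∫ x, sInf ((fun a => sqDist x a) '' α) ∂P

/-- The `n`th quantization error `Vₙ(P)`. -/
noncomputable def quantErr (P : Measure (ℝ × ℝ)) (n : ℕ) : ℝ :=
  sInf { v | ∃ α : Set (ℝ × ℝ), 1 ≤ α.encard ∧ α.encard ≤ (n : ℕ∞) ∧ v = distortion P α }

/-- `α` is an optimal set of `n`-means for `P`. -/
def IsOptimalSet (P : Measure (ℝ × ℝ)) (n : ℕ) (α : Set (ℝ × ℝ)) : Prop :=
  1 ≤ α.encard ∧ α.encard ≤ (n : ℕ∞) ∧ distortion P α = quantErr P n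


/-- The properties used of `G A B t = ∫ |A ξ + B η - t| dP`, where `ξ = 2 x₁ - 1` and
`η = 4 x₂ / √3 - 1` are the centred coordinates in which the vertices of the triangle are
`(-1, -1)`, `(1, -1)` and `(0, 1)`. -/
structure IsRSeminorm (G : ℝ → ℝ → ℝ → ℝ) : Prop where
  add_le : ∀ A B t A' B' t', G (A + A') (B + B') (t + t') ≤ G A B t + G A' B' t'
  smul_eq : ∀ c A B t, 0 ≤ c → G (c * A) (c * B) (c * t) = c * G A B t
  neg_eq : ∀ A B t, G (-A) (-B) (-t) = G A B t
  nonneg : ∀ A B t, 0 ≤ G A B t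
  self_similar : ∀ A B t, G A B t = 1 / 20 * G A B (4 * t + 3 * A + 3 * B)
    + 1 / 20 * G A B (4 * t - 3 * A + 3 * B) + 3 / 10 * G A B (2 * t - B)
  eq_neg_of_le : ∀ A B t, t ≤ A - B → t ≤ -A - B → t ≤ B → G A B t = -t

/-- Cauchy–Schwarz for the quadratic form `9/32 A² + 3/8 B² + t²`. -/
lemma sq_linear_form_le {α β γ : ℝ} (h : 32 / 9 * α ^ 2 + 8 / 3 * β ^ 2 + γ ^ 2 ≤ 1)
    (A B t : ℝ) :
    (α * A + β * B + γ * t) ^ 2 ≤ 9 / 32 * A ^ 2 + 3 / 8 * B ^ 2 + t ^ 2 := by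
  have hQ : 0 ≤ 9 / 32 * A ^ 2 + 3 / 8 * B ^ 2 + t ^ 2 := by positivity
  have h1 := mul_le_mul_of_nonneg_right h hQ
  nlinarith [sq_nonneg (α * B - 3 / 4 * β * A), sq_nonneg (α * t - 9 / 32 * γ * A),
    sq_nonneg (β * t - 3 / 8 * γ * B)]

namespace IsRSeminorm

variable {G : ℝ → ℝ → ℝ → ℝ}

lemma eq_of_ge (hG : IsRSeminorm G) (A B t : ℝ) (h₁ : A - B ≤ t) (h₂ : -A - B ≤ t) (h₃ : B ≤ t) :
    G A B t = t := by
  rw [← hG.neg_eq, hG.eq_neg_of_le _ _ _ (by linarith) (by linarith) (by linarith), neg_neg]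

lemma reflect (hG : IsRSeminorm G) : IsRSeminorm fun A B t => G (-A) B t where
  add_le A B t A' B' t' := by
    have := hG.add_le (-A) B t (-A') B' t'
    rwa [← neg_add] at this
  smul_eq c A B t hc := by
    have := hG.smul_eq c (-A) B t hc
    rwa [mul_neg] at this
  neg_eq A B t := hG.neg_eq (-A) B t
  nonneg A B t := hG.nonneg _ _ _
  self_similar A B t := by
    have h := hG.self_similar (-A) B t
    rw [show 4 * t + 3 * -A + 3 * B = 4 * t - 3 * A + 3 * B by ring,
      show 4 * t - 3 * -A + 3 * B = 4 * t + 3 * A + 3 * B by ring] at h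
    linarith
  eq_neg_of_le A B t h₁ h₂ h₃ := hG.eq_neg_of_le _ _ _ (by linarith) (by linarith) h₃

/-- On the cone spanned by three points, `G` is at most the linear interpolation of upper bounds
at these points. -/
lemma sq_le_of_cone (hG : IsRSeminorm G) {a₁ b₁ t₁ g₁ a₂ b₂ t₂ g₂ a₃ b₃ t₃ g₃ : ℝ}
    (h₁ : G a₁ b₁ t₁ = g₁) (h₂ : G a₂ b₂ t₂ = g₂) (h₃ : G a₃ b₃ t₃ = g₃)
    {A B t l₁ l₂ l₃ α β γ : ℝ} (hl₁ : 0 ≤ l₁) (hl₂ : 0 ≤ l₂) (hl₃ : 0 ≤ l₃)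
    (hA : l₁ * a₁ + l₂ * a₂ + l₃ * a₃ = A) (hB : l₁ * b₁ + l₂ * b₂ + l₃ * b₃ = B)
    (ht : l₁ * t₁ + l₂ * t₂ + l₃ * t₃ = t)
    (hg : l₁ * g₁ + l₂ * g₂ + l₃ * g₃ = α * A + β * B + γ * t)
    (h : 32 / 9 * α ^ 2 + 8 / 3 * β ^ 2 + γ ^ 2 ≤ 1) :
    G A B t ^ 2 ≤ 9 / 32 * A ^ 2 + 3 / 8 * B ^ 2 + t ^ 2 := by
  have h₁₂ := hG.add_le (l₁ * a₁) (l₁ * b₁) (l₁ * t₁) (l₂ * a₂) (l₂ * b₂) (l₂ * t₂)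
  have h₁₂₃ := hG.add_le (l₁ * a₁ + l₂ * a₂) (l₁ * b₁ + l₂ * b₂) (l₁ * t₁ + l₂ * t₂)
    (l₃ * a₃) (l₃ * b₃) (l₃ * t₃)
  rw [hG.smul_eq _ _ _ _ hl₁, hG.smul_eq _ _ _ _ hl₂, h₁, h₂] at h₁₂
  rw [hG.smul_eq _ _ _ _ hl₃, h₃, hA, hB, ht] at h₁₂₃
  have hle : G A B t ≤ α * A + β * B + γ * t := by linarith
  exact (pow_le_pow_left₀ (hG.nonneg A B t) hle 2).trans (sq_linear_form_le h A B t)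

/-- If `G` is known at the three preimages of a cut, it is known at the cut. -/
lemma eq_of_preimages (hG : IsRSeminorm G) {A B t v₁ v₂ v₃ g : ℝ}
    (h₁ : G A B (4 * t + 3 * A + 3 * B) = v₁) (h₂ : G A B (4 * t - 3 * A + 3 * B) = v₂)
    (h₃ : G A B (2 * t - B) = v₃) (hg : 1 / 20 * v₁ + 1 / 20 * v₂ + 3 / 10 * v₃ = g) :
    G A B t = g := by
  rw [hG.self_similar, h₁, h₂, h₃, hg]

lemma apply_eq_five_eighths (hG : IsRSeminorm G) : G 0 1 (-1 / 8) = 5 / 8 :=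
  hG.eq_of_preimages (hG.eq_of_ge _ _ _ (by norm_num) (by norm_num) (by norm_num))
    (hG.eq_of_ge _ _ _ (by norm_num) (by norm_num) (by norm_num))
    (hG.eq_neg_of_le _ _ _ (by norm_num) (by norm_num) (by norm_num)) (by norm_num)

lemma sq_le_of_nonneg (hG : IsRSeminorm G) {A B t : ℝ} (hA : 0 ≤ A) (hB : 0 ≤ B) :
    G A B t ^ 2 ≤ 9 / 32 * A ^ 2 + 3 / 8 * B ^ 2 + t ^ 2 := by
  have no : G 1 0 (-1/2) = 3/5 := by
    refine hG.eq_of_preimages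
      (hG.eq_of_ge _ _ _ (by norm_num) (by norm_num) (by norm_num))
      (hG.eq_neg_of_le _ _ _ (by norm_num) (by norm_num) (by norm_num))
      (hG.eq_neg_of_le _ _ _ (by norm_num) (by norm_num) (by norm_num))
      (by norm_num)
  have np : G 1 0 (1/2) = 3/5 := by
    refine hG.eq_of_preimages
      (hG.eq_of_ge _ _ _ (by norm_num) (by norm_num) (by norm_num))
      (hG.eq_neg_of_le _ _ _ (by norm_num) (by norm_num) (by norm_num))
      (hG.eq_of_ge _ _ _ (by norm_num) (by norm_num) (by norm_num))
      (by norm_num)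
  have na : G 0 1 (-1) = 1 := by
    rw [hG.eq_neg_of_le _ _ _ (by norm_num) (by norm_num) (by norm_num)]; norm_num
  have nb : G 0 1 (-1/2) = 7/10 := by
    refine hG.eq_of_preimages
      (hG.eq_of_ge _ _ _ (by norm_num) (by norm_num) (by norm_num))
      (hG.eq_of_ge _ _ _ (by norm_num) (by norm_num) (by norm_num))
      (hG.eq_neg_of_le _ _ _ (by norm_num) (by norm_num) (by norm_num))
      (by norm_num)
  have nc : G 0 1 0 = 3/5 := by
    refine hG.eq_of_preimages
      (hG.eq_of_ge _ _ _ (by norm_num) (by norm_num) (by norm_num))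
      (hG.eq_of_ge _ _ _ (by norm_num) (by norm_num) (by norm_num))
      (hG.eq_neg_of_le _ _ _ (by norm_num) (by norm_num) (by norm_num))
      (by norm_num)
  have nd : G 0 1 (1/4) = 61/100 := by
    refine hG.eq_of_preimages
      (hG.eq_of_ge _ _ _ (by norm_num) (by norm_num) (by norm_num))
      (hG.eq_of_ge _ _ _ (by norm_num) (by norm_num) (by norm_num))
      (Eq.trans (by norm_num) nb)
      (by norm_num)
  have ne : G 0 1 1 = 1 :=
    hG.eq_of_ge _ _ _ (by norm_num) (by norm_num) (by norm_num)
  have nf : G (2/5) 1 (-1/5) = 16/25 := by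
    refine hG.eq_of_preimages
      (hG.eq_of_ge _ _ _ (by norm_num) (by norm_num) (by norm_num))
      (hG.eq_of_ge _ _ _ (by norm_num) (by norm_num) (by norm_num))
      (hG.eq_neg_of_le _ _ _ (by norm_num) (by norm_num) (by norm_num))
      (by norm_num)
  have ng : G 1 1 (-1/2) = 9/10 := by
    refine hG.eq_of_preimages
      (hG.eq_of_ge _ _ _ (by norm_num) (by norm_num) (by norm_num))
      (hG.eq_neg_of_le _ _ _ (by norm_num) (by norm_num) (by norm_num))
      (hG.eq_neg_of_le _ _ _ (by norm_num) (by norm_num) (by norm_num))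
      (by norm_num)
  have nh : G 1 0 (-1) = 1 := by
    rw [hG.eq_neg_of_le _ _ _ (by norm_num) (by norm_num) (by norm_num)]; norm_num
  have ni : G 1 0 (-1/4) = 12/25 := by
    refine hG.eq_of_preimages
      (hG.eq_of_ge _ _ _ (by norm_num) (by norm_num) (by norm_num))
      (hG.eq_neg_of_le _ _ _ (by norm_num) (by norm_num) (by norm_num))
      (Eq.trans (by norm_num) no)
      (by norm_num)
  have nj : G 1 1 (1/4) = 67/100 := by
    refine hG.eq_of_preimages
      (hG.eq_of_ge _ _ _ (by norm_num) (by norm_num) (by norm_num))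
      (hG.eq_of_ge _ _ _ (by norm_num) (by norm_num) (by norm_num))
      (Eq.trans (by norm_num) ng)
      (by norm_num)
  have nk : G 1 0 1 = 1 :=
    hG.eq_of_ge _ _ _ (by norm_num) (by norm_num) (by norm_num)
  have nl : G 1 0 (1/4) = 12/25 := by
    refine hG.eq_of_preimages
      (hG.eq_of_ge _ _ _ (by norm_num) (by norm_num) (by norm_num))
      (hG.eq_neg_of_le _ _ _ (by norm_num) (by norm_num) (by norm_num))
      (Eq.trans (by norm_num) np)
      (by norm_num)
  rcases le_total t (-A - B) with h₀ | h₀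
  · rw [hG.eq_neg_of_le _ _ _ (by linarith) h₀ (by linarith)]
    nlinarith [sq_nonneg A, sq_nonneg B]
  rcases le_total (A + B) t with h₁ | h₁
  · rw [hG.eq_of_ge _ _ _ (by linarith) (by linarith) (by linarith)]
    nlinarith [sq_nonneg A, sq_nonneg B]
  rcases le_total A B with h₂ | h₂
  · rcases le_total t (-A / 2) with h₃ | h₃
    · rcases le_total t (A / 2 - B) with h₄ | h₄
      · exact hG.sq_le_of_cone na ng nh (l₁ := -(2 / 3 * A) + 1 / 3 * B - 2 / 3 * t)
          (l₂ := 2 / 3 * A + 2 / 3 * B + 2 / 3 * t) (l₃ := 1 / 3 * A - 2 / 3 * B - 2 / 3 * t)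
          (α := 4/15) (β := 4/15) (γ := -11/15)
          (by linarith) (by linarith) (by linarith) (by ring) (by ring) (by ring) (by ring)
          (by norm_num)
      · rcases le_total t (-B / 2) with h₅ | h₅
        · exact hG.sq_le_of_cone na nb ng (l₁ := -B - 2 * t)
            (l₂ := -A + 2 * B + 2 * t) (l₃ := A)
            (α := 1/5) (β := 2/5) (γ := -3/5)
            (by linarith) (by linarith) (by linarith) (by ring) (by ring) (by ring) (by ring)
            (by norm_num)
        · rcases le_total t (3 / 4 * A - B / 2) with h₆ | h₆
          · exact hG.sq_le_of_cone nb nf ng (l₁ := -A - 2 * t)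
              (l₂ := 5 / 3 * B + 10 / 3 * t) (l₃ := A - 2 / 3 * B - 4 / 3 * t)
              (α := 1/5) (β := 7/15) (γ := -7/15)
              (by linarith) (by linarith) (by linarith) (by ring) (by ring) (by ring) (by ring)
              (by norm_num)
          · exact hG.sq_le_of_cone nb nc nf (l₁ := -A - 2 * t)
              (l₂ := -(3 / 2 * A) + B + 2 * t) (l₃ := 5 / 2 * A)
              (α := 0) (β := 3/5) (γ := -1/5)
              (by linarith) (by linarith) (by linarith) (by ring) (by ring) (by ring) (by ring)
              (by norm_num)
    · rcases le_total t (3 / 4 * A - B / 2) with h₄ | h₄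
      · exact hG.sq_le_of_cone nf ng nj (l₁ := -(5 / 3 * A) + 5 / 3 * B)
          (l₂ := A - 2 / 3 * B - 4 / 3 * t) (l₃ := 2 / 3 * A + 4 / 3 * t)
          (α := 7/25) (β := 7/15) (γ := -23/75)
          (by linarith) (by linarith) (by linarith) (by ring) (by ring) (by ring) (by ring)
          (by norm_num)
      · rcases le_total t (A / 4) with h₅ | h₅
        · exact hG.sq_le_of_cone nc nf nj (l₁ := -(3 / 2 * A) + B + 2 * t)
            (l₂ := 5 / 6 * A - 10 / 3 * t) (l₃ := 2 / 3 * A + 4 / 3 * t)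
            (α := 2/25) (β := 3/5) (γ := -1/25)
            (by linarith) (by linarith) (by linarith) (by ring) (by ring) (by ring) (by ring)
            (by norm_num)
        · rcases le_total t (B / 4) with h₆ | h₆
          · exact hG.sq_le_of_cone nc nd nj (l₁ := B - 4 * t)
              (l₂ := -A + 4 * t) (l₃ := A)
              (α := 3/50) (β := 3/5) (γ := 1/25)
              (by linarith) (by linarith) (by linarith) (by ring) (by ring) (by ring) (by ring)
              (by norm_num)
          · rcases le_total t (B - 3 / 4 * A) with h₇ | h₇
            · exact hG.sq_le_of_cone nd ne nj (l₁ := -A + 4 / 3 * B - 4 / 3 * t)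
                (l₂ := -(1 / 3 * B) + 4 / 3 * t) (l₃ := A)
                (α := 3/50) (β := 12/25) (γ := 13/25)
                (by linarith) (by linarith) (by linarith) (by ring) (by ring) (by ring) (by ring)
                (by norm_num)
            · exact hG.sq_le_of_cone ne nj nk (l₁ := -(4 / 7 * A) + 3 / 7 * B + 4 / 7 * t)
                (l₂ := 4 / 7 * A + 4 / 7 * B - 4 / 7 * t) (l₃ := 3 / 7 * A - 4 / 7 * B + 4 / 7 * t)
                (α := 6/25) (β := 6/25) (γ := 19/25)
                (by linarith) (by linarith) (by linarith) (by ring) (by ring) (by ring) (by ring)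
                (by norm_num)
  · rcases le_total t (-B / 4 - A / 4) with h₃ | h₃
    · rcases le_total t (B / 2 - A) with h₄ | h₄
      · exact hG.sq_le_of_cone na ng nh (l₁ := -(2 / 3 * A) + 1 / 3 * B - 2 / 3 * t)
          (l₂ := 2 / 3 * A + 2 / 3 * B + 2 / 3 * t) (l₃ := 1 / 3 * A - 2 / 3 * B - 2 / 3 * t)
          (α := 4/15) (β := 4/15) (γ := -11/15)
          (by linarith) (by linarith) (by linarith) (by ring) (by ring) (by ring) (by ring)
          (by norm_num)
      · exact hG.sq_le_of_cone ng nh ni (l₁ := B)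
          (l₂ := -(1 / 3 * A) - 1 / 3 * B - 4 / 3 * t) (l₃ := 4 / 3 * A - 2 / 3 * B + 4 / 3 * t)
          (α := 23/75) (β := 37/150) (γ := -52/75)
          (by linarith) (by linarith) (by linarith) (by ring) (by ring) (by ring) (by ring)
          (by norm_num)
    · rcases le_total t (B / 2 - A / 4) with h₄ | h₄
      · exact hG.sq_le_of_cone ng ni nj (l₁ := -(1 / 3 * A) + 2 / 3 * B - 4 / 3 * t)
          (l₂ := A - B) (l₃ := 1 / 3 * A + 1 / 3 * B + 4 / 3 * t)
          (α := 121/300) (β := 103/300) (γ := -23/75)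
          (by linarith) (by linarith) (by linarith) (by ring) (by ring) (by ring) (by ring)
          (by norm_num)
      · rcases le_total t (A / 4) with h₅ | h₅
        · exact hG.sq_le_of_cone ni nj nl (l₁ := 1 / 2 * A - 2 * t)
            (l₂ := B) (l₃ := 1 / 2 * A - B + 2 * t)
            (α := 12/25) (β := 19/100) (γ := 0)
            (by linarith) (by linarith) (by linarith) (by ring) (by ring) (by ring) (by ring)
            (by norm_num)
        · rcases le_total t (A - 3 / 4 * B) with h₆ | h₆
          · exact hG.sq_le_of_cone nj nk nl (l₁ := B)
              (l₂ := -(1 / 3 * A) + 4 / 3 * t) (l₃ := 4 / 3 * A - B - 4 / 3 * t)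
              (α := 23/75) (β := 19/100) (γ := 52/75)
              (by linarith) (by linarith) (by linarith) (by ring) (by ring) (by ring) (by ring)
              (by norm_num)
          · exact hG.sq_le_of_cone ne nj nk (l₁ := -(4 / 7 * A) + 3 / 7 * B + 4 / 7 * t)
              (l₂ := 4 / 7 * A + 4 / 7 * B - 4 / 7 * t) (l₃ := 3 / 7 * A - 4 / 7 * B + 4 / 7 * t)
              (α := 6/25) (β := 6/25) (γ := 19/25)
              (by linarith) (by linarith) (by linarith) (by ring) (by ring) (by ring) (by ring)
              (by norm_num)

theorem sq_le (hG : IsRSeminorm G) (A B t : ℝ) :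
    G A B t ^ 2 ≤ 9 / 32 * A ^ 2 + 3 / 8 * B ^ 2 + t ^ 2 := by
  have key : ∀ A B t, 0 ≤ B → G A B t ^ 2 ≤ 9 / 32 * A ^ 2 + 3 / 8 * B ^ 2 + t ^ 2 := by
    intro A B t hB
    rcases le_total 0 A with hA | hA
    · exact hG.sq_le_of_nonneg hA hB
    · simpa using hG.reflect.sq_le_of_nonneg (A := -A) (t := t) (neg_nonneg.2 hA) hB
  rcases le_total 0 B with hB | hB
  · exact key A B t hB
  · have h := key (-A) (-B) (-t) (neg_nonneg.2 hB)
    rwa [hG.neg_eq, neg_sq, neg_sq, neg_sq] at h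

end IsRSeminorm

lemma continuous_Smap (i : Fin 3) : Continuous (Smap i) := by
  fin_cases i <;> simp only [Smap] <;> exact .prodMk (by fun_prop) (by fun_prop)

/-- The centred horizontal coordinate. -/
def xiCoord (x : ℝ × ℝ) : ℝ := 2 * x.1 - 1

/-- The centred vertical coordinate. -/
noncomputable def etaCoord (x : ℝ × ℝ) : ℝ := 4 / 3 * Real.sqrt 3 * x.2 - 1

@[fun_prop]
lemma continuous_xiCoord : Continuous xiCoord := by unfold xiCoord; fun_prop

@[fun_prop]
lemma continuous_etaCoord : Continuous etaCoord := by unfold etaCoord; fun_prop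

lemma xiCoord_Smap_zero (x : ℝ × ℝ) : xiCoord (Smap 0 x) = xiCoord x / 4 - 3 / 4 := by
  simp [Smap, xiCoord]; ring

lemma xiCoord_Smap_one (x : ℝ × ℝ) : xiCoord (Smap 1 x) = xiCoord x / 4 + 3 / 4 := by
  simp [Smap, xiCoord]; ring

lemma xiCoord_Smap_two (x : ℝ × ℝ) : xiCoord (Smap 2 x) = xiCoord x / 2 := by
  simp [Smap, xiCoord]; ring

lemma etaCoord_Smap_zero (x : ℝ × ℝ) : etaCoord (Smap 0 x) = etaCoord x / 4 - 3 / 4 := by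
  simp [Smap, etaCoord]; ring

lemma etaCoord_Smap_one (x : ℝ × ℝ) : etaCoord (Smap 1 x) = etaCoord x / 4 - 3 / 4 := by
  simp [Smap, etaCoord]; ring

lemma etaCoord_Smap_two (x : ℝ × ℝ) : etaCoord (Smap 2 x) = etaCoord x / 2 + 1 / 2 := by
  have h : Real.sqrt 3 * Real.sqrt 3 = 3 := Real.mul_self_sqrt (by norm_num)
  simp [Smap, etaCoord]; linear_combination (1 / 3) * h

lemma distortion_pair (P : Measure (ℝ × ℝ)) (a b : ℝ × ℝ) :
    distortion P {a, b} = ∫ x, min (sqDist x a) (sqDist x b) ∂P := by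
  simp only [distortion, image_pair, csInf_pair]

namespace IsRMeasure

variable {P : Measure (ℝ × ℝ)}

lemma measure_eq (hP : IsRMeasure P) {s : Set (ℝ × ℝ)} (hs : MeasurableSet s) :
    P s = 1 / 5 * P (Smap 0 ⁻¹' s) + 1 / 5 * P (Smap 1 ⁻¹' s) + 3 / 5 * P (Smap 2 ⁻¹' s) := by
  conv_lhs => rw [hP]
  simp [Measure.map_apply (continuous_Smap _).measurable hs]

variable [IsProbabilityMeasure P]

/-- A function whose positive superlevel sets are expanded by the inverse branches is almost
surely nonpositive. -/
lemma ae_nonpos (hP : IsRMeasure P) {g : ℝ × ℝ → ℝ} (hg : Measurable g)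
    (h : ∀ ε > 0, ∀ i x, ε < g (Smap i x) → 2 * ε < g x) : ∀ᵐ x ∂P, g x ≤ 0 := by
  have hstep : ∀ ε > 0, P {x | ε < g x} ≤ P {x | 2 * ε < g x} := by
    intro ε hε
    have hsub : ∀ i, P (Smap i ⁻¹' {x | ε < g x}) ≤ P {x | 2 * ε < g x} :=
      fun i => measure_mono fun x hx => h ε hε i x hx
    have hw : (1 / 5 + 1 / 5 + 3 / 5 : ℝ≥0∞) = 1 := by
      rw [ENNReal.div_add_div_same, ENNReal.div_add_div_same]
      norm_num
      exact ENNReal.div_self (by norm_num) (by norm_num)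
    calc P {x | ε < g x}
        ≤ 1 / 5 * P {x | 2 * ε < g x} + 1 / 5 * P {x | 2 * ε < g x}
          + 3 / 5 * P {x | 2 * ε < g x} := by
          rw [hP.measure_eq (measurableSet_lt measurable_const hg)]
          exact add_le_add (add_le_add (mul_le_mul' le_rfl (hsub 0)) (mul_le_mul' le_rfl (hsub 1)))
            (mul_le_mul' le_rfl (hsub 2))
      _ = P {x | 2 * ε < g x} := by rw [← add_mul, ← add_mul, hw, one_mul]
  have hpow : ∀ ε > 0, ∀ n : ℕ, P {x | ε < g x} ≤ P {x | 2 ^ n * ε < g x} := by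
    intro ε hε n
    induction n with
    | zero => simp
    | succ n ih =>
      refine ih.trans ((hstep _ (by positivity)).trans_eq ?_)
      rw [pow_succ', mul_assoc]
  have hnull : ∀ ε > 0, P {x | ε < g x} = 0 := by
    intro ε hε
    have hanti : Antitone fun n : ℕ => {x | 2 ^ n * ε < g x} := by
      intro m n hmn x hx
      have : (2 : ℝ) ^ m * ε ≤ 2 ^ n * ε := by gcongr; norm_num
      exact this.trans_lt hx
    have hlim := tendsto_measure_iInter_atTop (μ := P)
      (fun n => (measurableSet_lt measurable_const hg).nullMeasurableSet) hanti
      ⟨0, measure_ne_top _ _⟩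
    have hempty : ⋂ n : ℕ, {x | 2 ^ n * ε < g x} = ∅ := by
      ext x
      simp only [mem_iInter, mem_ofPred_eq, mem_empty_iff_false, iff_false, not_forall, not_lt]
      obtain ⟨n, hn⟩ := pow_unbounded_of_one_lt (g x / ε) (one_lt_two : (1 : ℝ) < 2)
      exact ⟨n, ((div_lt_iff₀ hε).1 hn).le⟩
    rw [hempty, measure_empty] at hlim
    exact le_antisymm (ge_of_tendsto' hlim (hpow ε hε)) (by simp)
  have hall : ∀ᵐ x ∂P, ∀ n : ℕ, g x ≤ 1 / ((n : ℝ) + 1) := by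
    rw [ae_all_iff]
    intro n
    rw [ae_iff]
    simpa only [not_le] using hnull (1 / ((n : ℝ) + 1)) (by positivity)
  filter_upwards [hall] with x hx
  exact ge_of_tendsto' tendsto_one_div_add_atTop_nhds_zero_nat hx

/-- `P` is carried by every half-plane containing the vertices of the triangle. -/
lemma ae_linear_le (hP : IsRMeasure P) {A B t : ℝ} (h₁ : A - B ≤ t) (h₂ : -A - B ≤ t)
    (h₃ : B ≤ t) : ∀ᵐ x ∂P, A * xiCoord x + B * etaCoord x ≤ t := by
  have := hP.ae_nonpos (g := fun x => A * xiCoord x + B * etaCoord x - t) (by fun_prop) ?_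
  · filter_upwards [this] with x hx using by linarith
  · intro ε hε i x hx
    fin_cases i <;>
    simp only [Fin.zero_eta, Fin.mk_one, Fin.reduceFinMk, xiCoord_Smap_zero, xiCoord_Smap_one,
      xiCoord_Smap_two, etaCoord_Smap_zero, etaCoord_Smap_one, etaCoord_Smap_two] at hx ⊢ <;>
    linarith

lemma integrable_of_continuous (hP : IsRMeasure P) {f : ℝ × ℝ → ℝ} (hf : Continuous f) :
    Integrable f P := by
  have hmem : ∀ᵐ x ∂P, x ∈ Icc (0 : ℝ) 1 ×ˢ Icc (0 : ℝ) 2 := by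
    filter_upwards [hP.ae_linear_le (A := 1) (B := 0) (t := 1) (by norm_num) (by norm_num)
      (by norm_num), hP.ae_linear_le (A := -1) (B := 0) (t := 1) (by norm_num) (by norm_num)
      (by norm_num), hP.ae_linear_le (A := 0) (B := 1) (t := 1) (by norm_num) (by norm_num)
      (by norm_num), hP.ae_linear_le (A := 0) (B := -1) (t := 1) (by norm_num) (by norm_num)
      (by norm_num)] with x h1 h2 h3 h4
    simp only [xiCoord, etaCoord] at h1 h2 h3 h4
    have hs : 1 ≤ Real.sqrt 3 := Real.one_le_sqrt.2 (by norm_num)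
    have hx : 0 ≤ x.2 := by
      by_contra! hneg
      nlinarith
    refine ⟨⟨by linarith, by linarith⟩, hx, ?_⟩
    nlinarith
  rw [← Measure.restrict_eq_self_of_ae_mem hmem]
  exact hf.continuousOn.integrableOn_compact (isCompact_Icc.prod isCompact_Icc)

lemma integral_eq (hP : IsRMeasure P) {f : ℝ × ℝ → ℝ} (hf : Continuous f) :
    ∫ x, f x ∂P = 1 / 5 * ∫ x, f (Smap 0 x) ∂P + 1 / 5 * ∫ x, f (Smap 1 x) ∂P
      + 3 / 5 * ∫ x, f (Smap 2 x) ∂P := by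
  have hi : ∀ i, Integrable f (P.map (Smap i)) := fun i =>
    (integrable_map_measure hf.aestronglyMeasurable (continuous_Smap i).aemeasurable).2
      (hP.integrable_of_continuous (hf.comp (continuous_Smap i)))
  have hc : ∀ k : ℝ≥0∞, k ≠ ⊤ → k / 5 ≠ ⊤ := fun k hk => ENNReal.div_ne_top hk (by norm_num)
  have h0 := (hi 0).smul_measure (hc 1 (by norm_num))
  have h1 := (hi 1).smul_measure (hc 1 (by norm_num))
  have h2 := (hi 2).smul_measure (hc 3 (by norm_num))
  conv_lhs => rw [hP]
  rw [integral_add_measure (h0.add_measure h1) h2, integral_add_measure h0 h1]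
  simp only [integral_smul_measure,
    integral_map (continuous_Smap _).aemeasurable hf.aestronglyMeasurable]
  simp

lemma integral_xiCoord (hP : IsRMeasure P) : ∫ x, xiCoord x ∂P = 0 := by
  have hi := hP.integrable_of_continuous continuous_xiCoord
  have h := hP.integral_eq continuous_xiCoord
  simp only [xiCoord_Smap_zero, xiCoord_Smap_one, xiCoord_Smap_two] at h
  rw [integral_sub (hi.div_const 4) (integrable_const _),
    integral_add (hi.div_const 4) (integrable_const _)] at h
  simp only [integral_div, integral_const, probReal_univ, smul_eq_mul, one_mul] at h
  linarith

lemma integral_etaCoord (hP : IsRMeasure P) : ∫ x, etaCoord x ∂P = 0 := by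
  have hi := hP.integrable_of_continuous continuous_etaCoord
  have h := hP.integral_eq continuous_etaCoord
  simp only [etaCoord_Smap_zero, etaCoord_Smap_one, etaCoord_Smap_two] at h
  rw [integral_sub (hi.div_const 4) (integrable_const _),
    integral_add (hi.div_const 2) (integrable_const _)] at h
  simp only [integral_div, integral_const, probReal_univ, smul_eq_mul, one_mul] at h
  linarith

lemma integral_quadratic (hP : IsRMeasure P) {f : ℝ × ℝ → ℝ} (hf : Continuous f)
    (hf0 : ∫ x, f x ∂P = 0) (a b c : ℝ) :
    ∫ x, (a * f x ^ 2 + b * f x + c) ∂P = a * ∫ x, f x ^ 2 ∂P + c := by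
  rw [integral_add (hP.integrable_of_continuous (by fun_prop)) (integrable_const _),
    integral_add (hP.integrable_of_continuous (by fun_prop))
      (hP.integrable_of_continuous (by fun_prop)), integral_const_mul, integral_const_mul, hf0]
  simp

lemma integral_xiCoord_sq (hP : IsRMeasure P) : ∫ x, xiCoord x ^ 2 ∂P = 3 / 11 := by
  have h := hP.integral_eq (f := fun x => xiCoord x ^ 2) (by fun_prop)
  have q := hP.integral_quadratic continuous_xiCoord hP.integral_xiCoord
  simp only [xiCoord_Smap_zero, xiCoord_Smap_one, xiCoord_Smap_two] at h
  have q0 := q (1 / 16) (-3 / 8) (9 / 16)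
  have q1 := q (1 / 16) (3 / 8) (9 / 16)
  have q2 := q (1 / 4) 0 0
  ring_nf at h q0 q1 q2
  linarith

lemma integral_etaCoord_sq (hP : IsRMeasure P) : ∫ x, etaCoord x ^ 2 ∂P = 5 / 11 := by
  have h := hP.integral_eq (f := fun x => etaCoord x ^ 2) (by fun_prop)
  have q := hP.integral_quadratic continuous_etaCoord hP.integral_etaCoord
  simp only [etaCoord_Smap_zero, etaCoord_Smap_one, etaCoord_Smap_two] at h
  have q0 := q (1 / 16) (-3 / 8) (9 / 16)
  have q2 := q (1 / 4) (1 / 2) (1 / 4)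
  ring_nf at h q0 q2
  linarith

lemma integral_linear (hP : IsRMeasure P) (A B t : ℝ) :
    ∫ x, (A * xiCoord x + B * etaCoord x - t) ∂P = -t := by
  rw [integral_sub (hP.integrable_of_continuous (by fun_prop)) (integrable_const _),
    integral_add (hP.integrable_of_continuous (by fun_prop))
      (hP.integrable_of_continuous (by fun_prop)), integral_const_mul, integral_const_mul,
    hP.integral_xiCoord, hP.integral_etaCoord]
  simp

lemma isRSeminorm (hP : IsRMeasure P) :
    IsRSeminorm fun A B t => ∫ x, |A * xiCoord x + B * etaCoord x - t| ∂P where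
  add_le A B t A' B' t' := by
    rw [← integral_add (hP.integrable_of_continuous (by fun_prop))
      (hP.integrable_of_continuous (by fun_prop))]
    refine integral_mono (hP.integrable_of_continuous (by fun_prop))
      (hP.integrable_of_continuous (by fun_prop)) fun x => ?_
    refine le_of_eq_of_le (congrArg _ ?_) (abs_add_le _ _)
    ring
  smul_eq c A B t hc := by
    rw [← integral_const_mul]
    refine integral_congr_ae (.of_forall fun x => ?_)
    simp only
    nth_rw 4 [← abs_of_nonneg hc]
    rw [← abs_mul]
    ring_nf
  neg_eq A B t := by
    refine integral_congr_ae (.of_forall fun x => ?_)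
    simp only
    rw [← abs_neg]
    ring_nf
  nonneg A B t := integral_nonneg fun x => abs_nonneg _
  self_similar A B t := by
    have hscale : ∀ k : ℝ, 0 < k → ∀ y z : ℝ, y / k = z → |z| = k⁻¹ * |y| := by
      rintro k hk y z rfl
      rw [abs_div, abs_of_pos hk, div_eq_inv_mul]
    rw [hP.integral_eq (by fun_prop)]
    simp only [xiCoord_Smap_zero, xiCoord_Smap_one, xiCoord_Smap_two, etaCoord_Smap_zero,
      etaCoord_Smap_one, etaCoord_Smap_two]
    have e0 : ∀ x, |A * (xiCoord x / 4 - 3 / 4) + B * (etaCoord x / 4 - 3 / 4) - t|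
        = 4⁻¹ * |A * xiCoord x + B * etaCoord x - (4 * t + 3 * A + 3 * B)| :=
      fun x => hscale 4 (by norm_num) _ _ (by ring)
    have e1 : ∀ x, |A * (xiCoord x / 4 + 3 / 4) + B * (etaCoord x / 4 - 3 / 4) - t|
        = 4⁻¹ * |A * xiCoord x + B * etaCoord x - (4 * t - 3 * A + 3 * B)| :=
      fun x => hscale 4 (by norm_num) _ _ (by ring)
    have e2 : ∀ x, |A * (xiCoord x / 2) + B * (etaCoord x / 2 + 1 / 2) - t|
        = 2⁻¹ * |A * xiCoord x + B * etaCoord x - (2 * t - B)| :=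
      fun x => hscale 2 (by norm_num) _ _ (by ring)
    simp only [e0, e1, e2, integral_const_mul]
    ring
  eq_neg_of_le A B t h₁ h₂ h₃ := by
    rw [← hP.integral_linear A B t]
    refine integral_congr_ae ?_
    filter_upwards [hP.ae_linear_le (A := -A) (B := -B) (t := -t) (by linarith) (by linarith)
      (by linarith)] with x hx
    exact abs_of_nonneg (by linarith)

/-- The distortion of a pair of points, in terms of the midpoint `c` and the half-difference
`d`. -/
lemma integral_min_sqDist (hP : IsRMeasure P) (c d : ℝ × ℝ) :
    ∫ x, min (sqDist x (c - d)) (sqDist x (c + d)) ∂P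
      = 27 / 176 + (c.1 - 1 / 2) ^ 2 + (c.2 - Real.sqrt 3 / 4) ^ 2 + d.1 ^ 2 + d.2 ^ 2
        - 2 * ∫ x, |d.1 / 2 * xiCoord x + Real.sqrt 3 / 4 * d.2 * etaCoord x
          - ((c.1 - 1 / 2) * d.1 + (c.2 - Real.sqrt 3 / 4) * d.2)| ∂P := by
  have hs : Real.sqrt 3 ^ 2 = 3 := Real.sq_sqrt (by norm_num)
  have hx1 : ∀ x : ℝ × ℝ, x.1 = xiCoord x / 2 + 1 / 2 := fun x => by simp only [xiCoord]; ring
  have hx2 : ∀ x : ℝ × ℝ, x.2 = Real.sqrt 3 / 4 * etaCoord x + Real.sqrt 3 / 4 := fun x => by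
    simp only [etaCoord]; linear_combination (-(1 / 3) * x.2) * hs
  set u := c.1 - 1 / 2 with hu
  set v := c.2 - Real.sqrt 3 / 4 with hv
  have hpt : ∀ x, min (sqDist x (c - d)) (sqDist x (c + d))
      = (1 / 4 * xiCoord x ^ 2 + -u * xiCoord x + (u ^ 2 + v ^ 2 + d.1 ^ 2 + d.2 ^ 2))
        + (3 / 16 * etaCoord x ^ 2 + (-(Real.sqrt 3 / 2 * v)) * etaCoord x + 0)
        - 2 * |d.1 / 2 * xiCoord x + Real.sqrt 3 / 4 * d.2 * etaCoord x
          - (u * d.1 + v * d.2)| := by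
    intro x
    have hdiff : sqDist x (c - d) - sqDist x (c + d) = 4 * (d.1 / 2 * xiCoord x
        + Real.sqrt 3 / 4 * d.2 * etaCoord x - (u * d.1 + v * d.2)) := by
      simp only [sqDist, Prod.fst_add, Prod.snd_add, Prod.fst_sub, Prod.snd_sub]
      rw [hx1 x, hx2 x, hu, hv]
      ring
    have hsum : sqDist x (c - d) + sqDist x (c + d) = 2 * (
        (1 / 4 * xiCoord x ^ 2 + -u * xiCoord x + (u ^ 2 + v ^ 2 + d.1 ^ 2 + d.2 ^ 2))
        + (3 / 16 * etaCoord x ^ 2 + (-(Real.sqrt 3 / 2 * v)) * etaCoord x + 0)) := by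
      simp only [sqDist, Prod.fst_add, Prod.snd_add, Prod.fst_sub, Prod.snd_sub]
      rw [hx1 x, hx2 x, hu, hv]
      linear_combination (1 / 8 * etaCoord x ^ 2) * hs
    have hmin := max_sub_min_eq_abs' (sqDist x (c - d)) (sqDist x (c + d))
    have hmax := min_add_max (sqDist x (c - d)) (sqDist x (c + d))
    rw [hdiff, abs_mul, abs_of_pos (by norm_num : (0 : ℝ) < 4)] at hmin
    linarith
  simp only [hpt]
  rw [integral_sub (hP.integrable_of_continuous (by fun_prop))
      (hP.integrable_of_continuous (by fun_prop)),
    integral_add (hP.integrable_of_continuous (by fun_prop))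
      (hP.integrable_of_continuous (by fun_prop)),
    hP.integral_quadratic continuous_xiCoord hP.integral_xiCoord,
    hP.integral_quadratic continuous_etaCoord hP.integral_etaCoord, integral_const_mul,
    hP.integral_xiCoord_sq, hP.integral_etaCoord_sq]
  ring

lemma le_distortion_pair (hP : IsRMeasure P) (a b : ℝ × ℝ) :
    117 / 1408 ≤ distortion P {a, b} := by
  obtain ⟨c, d, rfl, rfl⟩ : ∃ c d : ℝ × ℝ, a = c - d ∧ b = c + d :=
    ⟨(1 / 2 : ℝ) • (a + b), (1 / 2 : ℝ) • (b - a), by module, by module⟩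
  rw [distortion_pair, hP.integral_min_sqDist]
  set u := c.1 - 1 / 2
  set v := c.2 - Real.sqrt 3 / 4
  have hs : Real.sqrt 3 ^ 2 = 3 := Real.sq_sqrt (by norm_num)
  have h := hP.isRSeminorm.sq_le (d.1 / 2) (Real.sqrt 3 / 4 * d.2) (u * d.1 + v * d.2)
  set g := ∫ x, |d.1 / 2 * xiCoord x + Real.sqrt 3 / 4 * d.2 * etaCoord x
    - (u * d.1 + v * d.2)| ∂P
  have hcs : (u * d.1 + v * d.2) ^ 2 ≤ (u ^ 2 + v ^ 2) * (d.1 ^ 2 + d.2 ^ 2) := by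
    nlinarith [sq_nonneg (u * d.2 - v * d.1)]
  have hg : g ^ 2 ≤ (9 / 128 + (u ^ 2 + v ^ 2)) * (d.1 ^ 2 + d.2 ^ 2) := by
    have : (Real.sqrt 3 / 4 * d.2) ^ 2 = 3 / 16 * d.2 ^ 2 := by
      rw [mul_pow, div_pow, hs]; norm_num
    rw [this] at h
    linarith
  have h2 : 2 * g ≤ 9 / 128 + (u ^ 2 + v ^ 2) + (d.1 ^ 2 + d.2 ^ 2) := by
    refine le_of_sq_le_sq ?_ (by positivity)
    nlinarith [sq_nonneg (9 / 128 + (u ^ 2 + v ^ 2) - (d.1 ^ 2 + d.2 ^ 2))]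
  linarith

lemma distortion_optimal_pair (hP : IsRMeasure P) :
    distortion P {(1/2, Real.sqrt 3 / 16), (1/2, 3 * Real.sqrt 3 / 8)} = 117 / 1408 := by
  have hs : Real.sqrt 3 ^ 2 = 3 := Real.sq_sqrt (by norm_num)
  have h := hP.integral_min_sqDist (1 / 2, 7 * Real.sqrt 3 / 32) (0, 5 * Real.sqrt 3 / 32)
  have hG := hP.isRSeminorm.smul_eq (15 / 128) 0 1 (-1 / 8) (by norm_num)
  rw [hP.isRSeminorm.apply_eq_five_eighths] at hG
  have e₁ : Real.sqrt 3 / 4 * (5 * Real.sqrt 3 / 32) = 15 / 128 * 1 := by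
    linear_combination 5 / 128 * hs
  have e₂ : (7 * Real.sqrt 3 / 32 - Real.sqrt 3 / 4) * (5 * Real.sqrt 3 / 32)
      = 15 / 128 * (-1 / 8) := by linear_combination (-5 / 1024) * hs
  have e₃ : (0 : ℝ) / 2 = 15 / 128 * 0 := by norm_num
  simp only [e₁, e₂, e₃, mul_zero, zero_add, sub_self] at h hG
  rw [hG] at h
  rw [distortion_pair]
  convert h using 1
  · congr 1
    ext x
    congr 2 <;> ext <;> simp <;> ring
  · linear_combination (-26 / 1024) * hs

end IsRMeasure

lemma exists_eq_pair_of_encard_le_two {X : Type*} {s : Set X} (h₁ : 1 ≤ s.encard)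
    (h₂ : s.encard ≤ 2) : ∃ a b, s = {a, b} := by
  obtain ⟨a, ha⟩ := one_le_encard_iff_nonempty.1 h₁
  have h : (s \ {a}).encard ≤ 1 := by
    rw [← encard_sdiff_singleton_add_one ha, show (2 : ℕ∞) = 1 + 1 by norm_num] at h₂
    exact (ENat.add_le_add_iff_right (by norm_num)).1 h₂
  rw [← insert_sdiff_self_of_mem ha]
  rcases encard_le_one_iff_eq.1 h with h | ⟨b, h⟩
  · exact ⟨a, a, by simp [h]⟩
  · exact ⟨a, b, by rw [h]⟩

/-- `{(1/2, √3/16), (1/2, 3√3/8)}` is an optimal set of two-means and `V₂(P) = 117/1408`. -/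
theorem stmt_9 (P : Measure (ℝ × ℝ)) [IsProbabilityMeasure P] (hP : IsRMeasure P) :
    IsOptimalSet P 2
        ({(1/2, Real.sqrt 3 / 16), (1/2, 3 * Real.sqrt 3 / 8)} : Set (ℝ × ℝ)) ∧
    quantErr P 2 = 117/1408 := by
  have hα : 1 ≤ ({(1/2, Real.sqrt 3 / 16), (1/2, 3 * Real.sqrt 3 / 8)} : Set (ℝ × ℝ)).encard ∧
      ({(1/2, Real.sqrt 3 / 16), (1/2, 3 * Real.sqrt 3 / 8)} : Set (ℝ × ℝ)).encard
        ≤ ((2 : ℕ) : ℕ∞) :=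
    ⟨one_le_encard_iff_nonempty.2 (insert_nonempty _ _), (encard_insert_le _ _).trans
      (by rw [encard_singleton]; norm_num)⟩
  have hq : quantErr P 2 = 117/1408 := by
    refine IsLeast.csInf_eq ⟨⟨_, hα.1, hα.2, hP.distortion_optimal_pair.symm⟩, ?_⟩
    rintro _ ⟨β, h₁, h₂, rfl⟩
    obtain ⟨a, b, rfl⟩ := exists_eq_pair_of_encard_le_two h₁ (by exact_mod_cast h₂)
    exact hP.le_distortion_pair a b
  exact ⟨⟨hα.1, hα.2, hP.distortion_optimal_pair.trans hq.symm⟩, hq⟩
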